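/- arXiv:1607.07653 — 5 statements merged into one kernel-verified Lean document; each statement's English description precedes it below -/
import Mathlib

section
/- Let G = G(A) be the group generated by an invertible Mealy automaton A over the binary alphabet {0,1}, and let G₁ be its first level stabilizer. If every g ∈ G with g² = id belongs to G₁, then the identity is the only element of G satisfying g² = id. -/
/-- The automorphism group of the rooted binary tree `{0,1}*`, realized as the subgroup of
permutations of `List Bool` (finite binary words, with `[]` the root and `w` adjacent to
`w ++ [x]`) consisting of those permutations that fix the root and map children of a vertex
to children of its image (equivalently, bijections fixing the root and preserving adjacency). -/
def binTreeAut : Subgroup (Equiv.Perm (List Bool)) where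
  carrier := {f | f [] = [] ∧ ∀ (w : List Bool) (x : Bool), ∃ y : Bool, f (w ++ [x]) = f w ++ [y]}
  one_mem' := ⟨rfl, fun w x => ⟨x, rfl⟩⟩
  mul_mem' := by
    rintro f g ⟨hf0, hf⟩ ⟨hg0, hg⟩
    refine ⟨by simp [Equiv.Perm.mul_apply, hg0, hf0], ?_⟩
    intro w x
    obtain ⟨y, hy⟩ := hg w x
    obtain ⟨z, hz⟩ := hf (g w) y
    exact ⟨z, by simp [Equiv.Perm.mul_apply, hy, hz]⟩
  inv_mem' := by
    rintro f ⟨hf0, hf⟩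
    constructor
    · have h : f⁻¹ (f []) = [] := Equiv.symm_apply_apply f []
      rwa [hf0] at h
    · intro w x
      have hfv : f (f⁻¹ (w ++ [x])) = w ++ [x] := Equiv.apply_symm_apply f (w ++ [x])
      rcases List.eq_nil_or_concat (f⁻¹ (w ++ [x])) with hnil | ⟨w', x', hcons⟩
      · rw [hnil, hf0] at hfv
        exact absurd hfv.symm (by simp)
      · rw [hcons, List.concat_eq_append] at hfv
        obtain ⟨y, hy⟩ := hf w' x'
        rw [hy] at hfv
        have h2 := List.append_inj' hfv rfl
        have hw' : w' = f⁻¹ w := by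
          rw [← h2.1]; exact (Equiv.symm_apply_apply f w').symm
        refine ⟨x', ?_⟩
        rw [hcons, List.concat_eq_append, hw']

/-- A time-varying automaton over the binary alphabet `{0,1}` (encoded as `Bool`) with state
set `Q`: a sequence of transition functions and a sequence of output functions.  (Indexing of
the transitions starts here at `0`, corresponding to the first transition.) -/
structure TVAutomaton (Q : Type*) where
  phi : ℕ → Q → Bool → Q
  psi : ℕ → Q → Bool → Bool

namespace TVAutomaton

variable {Q : Type*}

/-- An automaton is invertible if all labelings `x ↦ psi i q x` are bijections. -/
def Invertible (A : TVAutomaton Q) : Prop := ∀ i q, Function.Bijective (A.psi i q)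

/-- A Mealy automaton is a time-varying automaton whose sequences of transition and output
functions are constant. -/
def IsMealy (A : TVAutomaton Q) : Prop := ∀ i, A.phi i = A.phi 0 ∧ A.psi i = A.psi 0

/-- The automaton transformation of the state `q` in its `i`-th transition. -/
def act (A : TVAutomaton Q) : ℕ → Q → List Bool → List Bool
  | _, _, [] => []
  | i, q, x :: w => A.psi i q x :: A.act (i + 1) (A.phi i q x) w

/-- The inverse automaton transformation (for invertible automata). -/
noncomputable def invAct (A : TVAutomaton Q) : ℕ → Q → List Bool → List Bool
  | _, _, [] => []
  | i, q, y :: u =>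
    Function.invFun (A.psi i q) y ::
      A.invAct (i + 1) (A.phi i q (Function.invFun (A.psi i q) y)) u

theorem act_invAct (A : TVAutomaton Q) (h : A.Invertible) :
    ∀ (u : List Bool) (i : ℕ) (q : Q), A.act i q (A.invAct i q u) = u := by
  intro u
  induction u with
  | nil => intro i q; rfl
  | cons y u ih =>
    intro i q
    rw [invAct, act, ih]
    congr 1
    exact Function.rightInverse_invFun (h i q).2 y

theorem invAct_act (A : TVAutomaton Q) (h : A.Invertible) :
    ∀ (w : List Bool) (i : ℕ) (q : Q), A.invAct i q (A.act i q w) = w := by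
  intro w
  induction w with
  | nil => intro i q; rfl
  | cons x w ih =>
    intro i q
    have hx : Function.invFun (A.psi i q) (A.psi i q x) = x :=
      Function.leftInverse_invFun (h i q).1 x
    rw [act, invAct, hx, ih]

/-- The automaton transformation of the state `q` in its `i`-th transition, as a
permutation of the set of binary words. -/
noncomputable def toPerm (A : TVAutomaton Q) (h : A.Invertible) (i : ℕ) (q : Q) :
    Equiv.Perm (List Bool) where
  toFun := A.act i q
  invFun := A.invAct i q
  left_inv := fun w => A.invAct_act h w i q
  right_inv := fun u => A.act_invAct h u i q

theorem act_concat (A : TVAutomaton Q) :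
    ∀ (w : List Bool) (i : ℕ) (q : Q) (x : Bool),
      ∃ y, A.act i q (w ++ [x]) = A.act i q w ++ [y] := by
  intro w
  induction w with
  | nil => intro i q x; exact ⟨A.psi i q x, rfl⟩
  | cons a w ih =>
    intro i q x
    obtain ⟨y, hy⟩ := ih (i + 1) (A.phi i q a) x
    refine ⟨y, ?_⟩
    show A.psi i q a :: A.act (i + 1) (A.phi i q a) (w ++ [x]) = _
    rw [hy]; rfl

/-- The automaton transformation of the state `q` in its `i`-th transition, as an
automorphism of the rooted binary tree. -/
noncomputable def toAut (A : TVAutomaton Q) (h : A.Invertible) (i : ℕ) (q : Q) :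
    ↥binTreeAut :=
  ⟨A.toPerm h i q, ⟨rfl, fun w x => A.act_concat w i q x⟩⟩

/-- The group `G(A)` generated by an invertible time-varying automaton `A`: the subgroup of
`Aut({0,1}*)` generated by the transformations of all states of `A` in their first
transition. -/
noncomputable def genGroup (A : TVAutomaton Q) (h : A.Invertible) : Subgroup ↥binTreeAut :=
  Subgroup.closure (Set.range fun q => A.toAut h 0 q)

end TVAutomaton

/-- A tree automorphism belongs to the first level stabilizer: it fixes both one-letter
words. -/
def FixesLevelOne (g : ↥binTreeAut) : Prop :=
  (g : Equiv.Perm (List Bool)) [false] = [false] ∧ (g : Equiv.Perm (List Bool)) [true] = [true]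

namespace TVAutomaton

variable {Q : Type*}

/-- The transformations of a Mealy automaton do not depend on the starting time. -/
theorem IsMealy.act_eq {A : TVAutomaton Q} (hM : A.IsMealy) (i : ℕ) (q : Q) (w : List Bool) :
    A.act i q w = A.act 0 q w := by
  suffices key : ∀ (w : List Bool) (i j : ℕ) (q : Q), A.act i q w = A.act j q w from key w i 0 q
  intro w
  induction w with
  | nil => intro i j q; rfl
  | cons x w ih =>
    intro i j q
    simp only [act]
    rw [(hM i).1, (hM i).2, (hM j).1, (hM j).2, ih (i + 1) (j + 1)]

/-- The group generated by a Mealy automaton is self-similar: sections of its elements at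
one-letter words belong to the group. -/
theorem IsMealy.exists_section {A : TVAutomaton Q} (h : A.Invertible) (hM : A.IsMealy)
    {g : ↥binTreeAut} (hg : g ∈ A.genGroup h) :
    ∃ σ : Equiv.Perm Bool, ∀ x, ∃ k ∈ A.genGroup h, ∀ w : List Bool,
      (g : Equiv.Perm (List Bool)) (x :: w) = σ x :: (k : Equiv.Perm (List Bool)) w := by
  induction hg using Subgroup.closure_induction with
  | mem g hg =>
    obtain ⟨q, rfl⟩ := hg
    refine ⟨Equiv.ofBijective _ (h 0 q), fun x =>
      ⟨A.toAut h 0 (A.phi 0 q x), Subgroup.subset_closure ⟨_, rfl⟩, fun w => ?_⟩⟩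
    exact congrArg (A.psi 0 q x :: ·) (hM.act_eq 1 (A.phi 0 q x) w)
  | one => exact ⟨1, fun x => ⟨1, one_mem _, fun w => rfl⟩⟩
  | mul a b _ _ iha ihb =>
    obtain ⟨σ, hσ⟩ := iha
    obtain ⟨τ, hτ⟩ := ihb
    refine ⟨σ * τ, fun x => ?_⟩
    obtain ⟨l, hl, hbl⟩ := hτ x
    obtain ⟨k, hk, hak⟩ := hσ (τ x)
    exact ⟨k * l, mul_mem hk hl, fun w => by simp [hbl, hak]⟩
  | inv a _ iha =>
    obtain ⟨σ, hσ⟩ := iha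
    refine ⟨σ⁻¹, fun x => ?_⟩
    obtain ⟨k, hk, hak⟩ := hσ (σ⁻¹ x)
    refine ⟨k⁻¹, inv_mem hk, fun w => ?_⟩
    rw [Subgroup.coe_inv, Equiv.Perm.inv_eq_iff_eq, hak]
    simp

end TVAutomaton

/-- Let `G = G(A)` for an invertible Mealy automaton `A` over the binary
alphabet, and let `G₁` be the first level stabilizer.  If every involution of `G` lies in
`G₁`, then the identity is the only element `g ∈ G` with `g ^ 2 = 1`. -/
theorem mealy_involutions_trivial (Q : Type) [Finite Q]
    (A : TVAutomaton Q) (h : A.Invertible) (hM : A.IsMealy)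
    (hI : ∀ g ∈ A.genGroup h, g ^ 2 = 1 → FixesLevelOne g) :
    ∀ g ∈ A.genGroup h, g ^ 2 = 1 → g = 1 := by
  suffices key : ∀ (w : List Bool), ∀ g ∈ A.genGroup h, g ^ 2 = 1 →
      (g : Equiv.Perm (List Bool)) w = w from
    fun g hg hg2 => Subtype.ext (Equiv.ext fun w => key w g hg hg2)
  intro w
  induction w with
  | nil => exact fun g _ _ => g.2.1
  | cons x w ih =>
    intro g hg hg2
    obtain ⟨σ, hσ⟩ := hM.exists_section h hg
    obtain ⟨k, hk, hgk⟩ := hσ x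
    have hσx : σ x = x := by
      have hfix : (g : Equiv.Perm (List Bool)) [x] = [x] := by
        cases x
        exacts [(hI g hg hg2).1, (hI g hg hg2).2]
      exact (List.cons.inj ((hgk []).symm.trans hfix)).1
    rw [hσx] at hgk
    have hk2 : k ^ 2 = 1 := by
      refine Subtype.ext (Equiv.ext fun u => ?_)
      have hu : ((g ^ 2 : ↥binTreeAut) : Equiv.Perm (List Bool)) (x :: u) = x :: u := by
        rw [hg2]; rfl
      simpa [sq, hgk] using hu
    rw [hgk, ih k hk hk2]
end

section
/- Let n ≥ 2 and let A be the Mealy automaton over X = {0,1} with state set Q = {a_1, …, a_n}, transition function φ(a_j, x) = a_{j−1} for 2 < j ≤ n, φ(a_2, 0) = a_n, φ(a_2, 1) = a_1, φ(a_1, x) = a_1, and output function ψ(a_2, x) = 1 − x and ψ(a_j, x) = x for j ≠ 2 (for all x ∈ X). Then A is invertible and G(A) is isomorphic to the free abelian group of rank n − 1. -/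
namespace InterleavedOdometer

variable {k : ℕ}

/-- The vector obtained from `v` after reading the letter `x`: the coordinates move one place
to the left and the carry of the addition of `v 0` to the digit `x` enters at the end. -/
def step (v : Fin (k + 1) → ℤ) (x : Bool) (i : Fin (k + 1)) : ℤ :=
  if h : i.val + 1 < k + 1 then v ⟨i.val + 1, h⟩ else ((x.toNat : ℤ) + v 0) / 2

/-- The digit obtained by adding `v 0` to the digit `x`. -/
def digit (v : Fin (k + 1) → ℤ) (x : Bool) : Bool :=
  decide (((x.toNat : ℤ) + v 0) % 2 = 1)

/-- A vector `v` acts on a word by adding `v i` to the 2-adic integer formed by the letters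
whose positions are congruent to `i` modulo `k + 1`. -/
def run : (Fin (k + 1) → ℤ) → List Bool → List Bool
  | _, [] => []
  | v, x :: w => digit v x :: run (step v x) w

theorem toNat_digit (v : Fin (k + 1) → ℤ) (x : Bool) :
    ((digit v x).toNat : ℤ) = ((x.toNat : ℤ) + v 0) % 2 := by
  rcases Int.emod_two_eq_zero_or_one ((x.toNat : ℤ) + v 0) with h | h <;> simp [digit, h]

theorem digit_add (u v : Fin (k + 1) → ℤ) (x : Bool) :
    digit (u + v) x = digit u (digit v x) := by
  rw [digit, digit, toNat_digit, Pi.add_apply]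
  congr 1
  apply propext
  omega

theorem step_add (u v : Fin (k + 1) → ℤ) (x : Bool) :
    step (u + v) x = step u (digit v x) + step v x := by
  funext i
  simp only [step, Pi.add_apply, toNat_digit]
  split_ifs
  · rfl
  · omega

theorem run_add (u v : Fin (k + 1) → ℤ) (w : List Bool) : run (u + v) w = run u (run v w) := by
  induction w generalizing u v with
  | nil => rfl
  | cons x w ih => simp only [run, digit_add, step_add, ih]

theorem digit_zero (x : Bool) : digit (0 : Fin (k + 1) → ℤ) x = x := by
  cases x <;> simp [digit]

theorem step_zero (x : Bool) : step (0 : Fin (k + 1) → ℤ) x = 0 := by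
  funext i
  cases x <;> simp [step]

theorem run_zero (w : List Bool) : run (0 : Fin (k + 1) → ℤ) w = w := by
  induction w with
  | nil => rfl
  | cons x w ih => rw [run, digit_zero, step_zero, ih]

theorem run_concat (v : Fin (k + 1) → ℤ) (w : List Bool) (x : Bool) :
    ∃ y, run v (w ++ [x]) = run v w ++ [y] := by
  induction w generalizing v with
  | nil => exact ⟨digit v x, rfl⟩
  | cons a w ih =>
    obtain ⟨y, hy⟩ := ih (step v a)
    exact ⟨y, by simp [run, hy]⟩

/-- The action `run` as a homomorphism into the automorphism group of the binary tree. -/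
def runHom (k : ℕ) : Multiplicative (Fin (k + 1) → ℤ) →* ↥binTreeAut where
  toFun v :=
    ⟨{ toFun := run v.toAdd
       invFun := run (-v.toAdd)
       left_inv := fun w => by rw [← run_add, neg_add_cancel, run_zero]
       right_inv := fun w => by rw [← run_add, add_neg_cancel, run_zero] },
      rfl, run_concat v.toAdd⟩
  map_one' := Subtype.ext (Equiv.ext fun w => run_zero w)
  map_mul' u v := Subtype.ext (Equiv.ext fun w => run_add u.toAdd v.toAdd w)

theorem step_false_last (v : Fin (k + 1) → ℤ) : step v false (Fin.last k) = v 0 / 2 := by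
  simp [step]

theorem two_dvd_of_run_eq {v : Fin (k + 1) → ℤ} (hv : ∀ w, run v w = w) : 2 ∣ v 0 := by
  have h := hv [false]
  simp only [run, digit, Bool.toNat_false, List.cons.injEq, decide_eq_false_iff_not] at h
  omega

theorem two_pow_dvd_of_run_eq (t : ℕ) :
    ∀ v : Fin (k + 1) → ℤ, (∀ w, run v w = w) → ∀ i, (2 : ℤ) ^ t ∣ v i := by
  induction t with
  | zero => simp
  | succ t ih =>
    suffices H : ∀ (i : ℕ) (hi : i < k + 1) (v : Fin (k + 1) → ℤ), (∀ w, run v w = w) →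
        (2 : ℤ) ^ (t + 1) ∣ v ⟨i, hi⟩ from fun v hv i => H i i.isLt v hv
    intro i
    have hstep (v : Fin (k + 1) → ℤ) (hv : ∀ w, run v w = w) (w : List Bool) :
        run (step v false) w = w := (List.cons.inj (hv (false :: w))).2
    induction i with
    | zero =>
      intro hi v hv
      obtain ⟨c, hc⟩ := ih _ (hstep v hv) (Fin.last k)
      rw [step_false_last] at hc
      refine ⟨c, ?_⟩
      change v 0 = _
      rw [← Int.ediv_mul_cancel (two_dvd_of_run_eq hv), hc]
      ring
    | succ i ihi =>
      intro hi v hv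
      have h := ihi (by omega) _ (hstep v hv)
      rwa [step, dif_pos hi] at h

theorem runHom_injective (k : ℕ) : Function.Injective (runHom k) := by
  refine (injective_iff_map_eq_one _).2 fun v hv => ?_
  have hrun (w : List Bool) : run v.toAdd w = w :=
    congrArg (fun g : ↥binTreeAut => (g : Equiv.Perm (List Bool)) w) hv
  apply Multiplicative.toAdd.injective
  funext i
  by_contra hne
  have hdvd := two_pow_dvd_of_run_eq (v.toAdd i).natAbs v.toAdd hrun i
  have hlt := Nat.lt_two_pow_self (n := (v.toAdd i).natAbs)
  have hle := Nat.le_of_dvd (Int.natAbs_pos.2 hne) (Int.natAbs_dvd_natAbs.2 hdvd)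
  rw [Int.natAbs_pow] at hle
  exact absurd hle (not_le.2 hlt)

/-- The vector by which the state `q` of the sausage automaton acts. -/
def stateVec (q : Fin (k + 2)) (i : Fin (k + 1)) : ℤ := if i.val + 1 = q.val then -1 else 0

theorem stateVec_succ (i : Fin (k + 1)) : stateVec i.succ = -Pi.single i 1 := by
  funext j
  by_cases h : j = i
  · simp [stateVec, h]
  · simp [stateVec, h, Fin.val_inj]

theorem digit_stateVec (q : Fin (k + 2)) (x : Bool) :
    digit (stateVec q) x = if q.val = 1 then !x else x := by
  by_cases h : q.val = 1
  · cases x <;> simp [digit, stateVec, h]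
  · cases x <;> simp [digit, stateVec, h, Ne.symm h]

theorem step_stateVec (q : Fin (k + 2)) (x : Bool) :
    step (stateVec q) x = stateVec
      (if 2 ≤ q.val then ⟨q.val - 1, by have := q.isLt; omega⟩
        else if q.val = 1 then
          (if x then (⟨0, by omega⟩ : Fin (k + 2)) else ⟨k + 2 - 1, by omega⟩)
        else ⟨0, by omega⟩) := by
  funext i
  have hi := i.isLt
  have hq := q.isLt
  by_cases h₂ : 2 ≤ q.val
  · simp only [step, stateVec, if_pos h₂]
    cases x <;> simp <;> split_ifs <;> omega
  · by_cases h₁ : q.val = 1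
    · cases x
      · simp [step, stateVec, h₁]
        split_ifs <;> omega
      · simp [step, stateVec, h₁]
    · cases x <;> simp [step, stateVec, h₁, h₂, Ne.symm h₁] <;> omega

theorem range_runHom (k : ℕ) :
    (runHom k).range =
      Subgroup.closure (Set.range fun q => runHom k (Multiplicative.ofAdd (stateVec q))) := by
  apply le_antisymm
  · rintro _ ⟨v, rfl⟩
    set S := (Subgroup.closure
      (Set.range fun q => runHom k (Multiplicative.ofAdd (stateVec q)))).comap (runHom k)
    have hsingle (i : Fin (k + 1)) :
        (Multiplicative.ofAdd (Pi.single i 1 : Fin (k + 1) → ℤ)) ∈ S := by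
      have h : Multiplicative.ofAdd (stateVec i.succ) ∈ S :=
        Subgroup.subset_closure ⟨i.succ, rfl⟩
      rw [stateVec_succ, ofAdd_neg] at h
      exact inv_mem_iff.1 h
    change v ∈ S
    have hv : v = ∏ i, (Multiplicative.ofAdd (Pi.single i 1 : Fin (k + 1) → ℤ)) ^ v.toAdd i := by
      apply Multiplicative.toAdd.injective
      rw [toAdd_prod]
      simp only [toAdd_zpow, toAdd_ofAdd]
      exact pi_eq_sum_univ' _
    rw [hv]
    exact prod_mem fun i _ => zpow_mem (hsingle i) _
  · rw [Subgroup.closure_le]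
    rintro _ ⟨q, rfl⟩
    exact ⟨_, rfl⟩

end InterleavedOdometer

/-- The "sausage" Mealy automaton, with states `a_1, …, a_n` (encoded as
`0, …, n - 1` in `Fin n`), transition function `φ(a_j, x) = a_{j-1}` for `2 < j ≤ n`,
`φ(a_2, 0) = a_n`, `φ(a_2, 1) = a_1`, `φ(a_1, x) = a_1`, and output function
`ψ(a_2, x) = 1 - x`, `ψ(a_j, x) = x` for `j ≠ 2`, is invertible and generates a group
isomorphic to the free abelian group of rank `n - 1`. -/
theorem sausage_automaton_free_abelian (n : ℕ) (hn : 2 ≤ n) (A : TVAutomaton (Fin n))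
    (hphi : ∀ (i : ℕ) (q : Fin n) (x : Bool),
      A.phi i q x =
        if 2 ≤ q.val then ⟨q.val - 1, by have := q.isLt; omega⟩
        else if q.val = 1 then
          (if x then (⟨0, by omega⟩ : Fin n) else ⟨n - 1, by omega⟩)
        else ⟨0, by omega⟩)
    (hpsi : ∀ (i : ℕ) (q : Fin n) (x : Bool), A.psi i q x = if q.val = 1 then !x else x) :
    ∃ h : A.Invertible, Nonempty (A.genGroup h ≃* Multiplicative (Fin (n - 1) → ℤ)) := by
  obtain ⟨k, rfl⟩ := Nat.exists_eq_add_of_le' hn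
  have hinv : A.Invertible := by
    intro i q
    rw [show A.psi i q = fun x => if q.val = 1 then !x else x from funext (hpsi i q)]
    split_ifs
    · exact Bool.involutive_not.bijective
    · exact Function.bijective_id
  have hact (w : List Bool) : ∀ i q,
      A.act i q w = InterleavedOdometer.run (InterleavedOdometer.stateVec q) w := by
    induction w with
    | nil => exact fun _ _ => rfl
    | cons x w ih =>
      intro i q
      rw [TVAutomaton.act, InterleavedOdometer.run, ih, hpsi, hphi,
        InterleavedOdometer.digit_stateVec, InterleavedOdometer.step_stateVec]
  have hgen : A.genGroup hinv = (InterleavedOdometer.runHom k).range := by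
    rw [InterleavedOdometer.range_runHom, TVAutomaton.genGroup]
    congr 2
    funext q
    exact Subtype.ext (Equiv.ext fun w => hact w 0 q)
  exact ⟨hinv, ⟨(MulEquiv.subgroupCongr hgen).trans
    (MonoidHom.ofInjective (InterleavedOdometer.runHom_injective k)).symm⟩⟩
end

section
/- Let n ≥ 1 and let A be the Mealy automaton over X = {0,1} with state set Q = {a_1, …, a_n}, transition function φ(a_j, x) = a_{j−1} for 2 ≤ j ≤ n and φ(a_1, x) = a_n, and output function ψ(a_1, x) = 1 − x and ψ(a_j, x) = x for j ≥ 2 (for all x ∈ X). Then A is invertible and G(A) is isomorphic to the elementary abelian 2-group (ℤ/2ℤ)^n of rank n. -/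
/-- Flip the letters of a binary word at the positions where the sequence `s` is nonzero. -/
def toggleWord : (ℕ → ZMod 2) → List Bool → List Bool
  | _, [] => []
  | s, x :: w => (if s 0 = 0 then x else !x) :: toggleWord (fun k => s (k + 1)) w

theorem toggleWord_zero (w : List Bool) : toggleWord 0 w = w := by
  induction w with
  | nil => rfl
  | cons x w ih =>
    change (if (0 : ZMod 2) = 0 then x else !x) :: toggleWord 0 w = x :: w
    rw [ih, if_pos rfl]

theorem toggleWord_add (w : List Bool) (s t : ℕ → ZMod 2) :
    toggleWord (s + t) w = toggleWord s (toggleWord t w) := by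
  induction w generalizing s t with
  | nil => rfl
  | cons x w ih =>
    have hbit : ∀ (a b : ZMod 2) (x : Bool), (if a + b = 0 then x else !x) =
        if a = 0 then (if b = 0 then x else !x) else !(if b = 0 then x else !x) := by decide
    exact congrArg₂ List.cons (hbit (s 0) (t 0) x) (ih (fun k => s (k + 1)) fun k => t (k + 1))

theorem toggleWord_concat (w : List Bool) (s : ℕ → ZMod 2) (x : Bool) :
    ∃ y, toggleWord s (w ++ [x]) = toggleWord s w ++ [y] := by
  induction w generalizing s with
  | nil => exact ⟨_, rfl⟩
  | cons a w ih =>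
    obtain ⟨y, hy⟩ := ih fun k => s (k + 1)
    exact ⟨y, congrArg (List.cons _) hy⟩

theorem toggleWord_injective : Function.Injective toggleWord := by
  intro s t h
  funext k
  induction k generalizing s t with
  | zero =>
    have h0 : (if s 0 = 0 then true else false) = if t 0 = 0 then true else false :=
      (List.cons.inj (congrFun h [true])).1
    have hbit : ∀ a b : ZMod 2,
        (if a = 0 then true else false) = (if b = 0 then true else false) → a = b := by decide
    exact hbit _ _ h0
  | succ k ih =>
    exact ih (s := fun k => s (k + 1)) (t := fun k => t (k + 1))
      (funext fun w => (List.cons.inj (congrFun h (true :: w))).2)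

/-- Toggling letters, as a homomorphism from sequences over `ℤ/2ℤ` to tree automorphisms. -/
def toggleHom : Multiplicative (ℕ → ZMod 2) →* ↥binTreeAut where
  toFun s :=
    ⟨{  toFun := toggleWord s.toAdd
        invFun := toggleWord s.toAdd
        left_inv := fun w => by
          rw [← toggleWord_add, ZModModule.add_self, toggleWord_zero]
        right_inv := fun w => by
          rw [← toggleWord_add, ZModModule.add_self, toggleWord_zero] },
      rfl, fun w x => toggleWord_concat w s.toAdd x⟩
  map_one' := Subtype.ext (Equiv.ext toggleWord_zero)
  map_mul' s t := Subtype.ext (Equiv.ext fun w => toggleWord_add w s.toAdd t.toAdd)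

theorem toggleHom_injective : Function.Injective toggleHom := fun _ _ h =>
  toggleWord_injective (congrArg (fun g : ↥binTreeAut => ⇑(g : Equiv.Perm (List Bool))) h)

/-- The `n`-periodic extension of a vector indexed by `Fin n` to a sequence. -/
def periodicExtension {n : ℕ} (hn : 1 ≤ n) : (Fin n → ZMod 2) →+ (ℕ → ZMod 2) where
  toFun v k := v ⟨k % n, Nat.mod_lt k hn⟩
  map_zero' := rfl
  map_add' _ _ := rfl

theorem periodicExtension_injective {n : ℕ} (hn : 1 ≤ n) :
    Function.Injective (periodicExtension hn) := by
  intro v w h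
  funext i
  have hi : (⟨i.val % n, Nat.mod_lt i.val hn⟩ : Fin n) = i := Fin.ext (Nat.mod_eq_of_lt i.isLt)
  have hk : v ⟨i.val % n, Nat.mod_lt i.val hn⟩ = w ⟨i.val % n, Nat.mod_lt i.val hn⟩ :=
    congrFun h i.val
  rwa [hi] at hk

theorem periodicExtension_single {n : ℕ} (hn : 1 ≤ n) (q : Fin n) (k : ℕ) :
    periodicExtension hn (Pi.single q 1) k = if k % n = q.val then 1 else 0 := by
  simp [periodicExtension, Pi.single_apply, Fin.ext_iff]

theorem closure_range_ofAdd_single (n : ℕ) :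
    Subgroup.closure (Set.range fun q : Fin n =>
      Multiplicative.ofAdd (Pi.single q 1 : Fin n → ZMod 2)) = ⊤ := by
  refine eq_top_iff.2 fun v _ => ?_
  have hv : v = ∏ i, Multiplicative.ofAdd (Pi.single i (v.toAdd i) : Fin n → ZMod 2) := by
    rw [← ofAdd_sum, Finset.univ_sum_single, ofAdd_toAdd]
  rw [hv]
  refine Subgroup.prod_mem _ fun i _ => ?_
  have hbit : ∀ a : ZMod 2, a = 0 ∨ a = 1 := by decide
  rcases hbit (v.toAdd i) with h | h
  · rw [h, Pi.single_zero]
    exact one_mem _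
  · rw [h]
    exact Subgroup.subset_closure ⟨i, rfl⟩

theorem succ_mod_eq_iff {n : ℕ} (hn : 1 ≤ n) (k q : ℕ) (hq : q < n) :
    (k + 1) % n = q ↔ k % n = if 1 ≤ q then q - 1 else n - 1 := by
  have hk := Nat.mod_lt k hn
  rw [← Nat.mod_add_mod]
  by_cases h : k % n + 1 = n
  · rw [h, Nat.mod_self]
    split_ifs <;> omega
  · rw [Nat.mod_eq_of_lt (by omega)]
    split_ifs <;> omega

/-- The cyclic Mealy automaton with states `a_1, …, a_n` (encoded as
`0, …, n - 1` in `Fin n`), transition function `φ(a_j, x) = a_{j-1}` for `2 ≤ j ≤ n` and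
`φ(a_1, x) = a_n`, and output function `ψ(a_1, x) = 1 - x`, `ψ(a_j, x) = x` for `j ≥ 2`, is
invertible and generates a group isomorphic to the elementary abelian 2-group of rank
`n`. -/
theorem cyclic_automaton_elementary_abelian (n : ℕ) (hn : 1 ≤ n) (A : TVAutomaton (Fin n))
    (hphi : ∀ (i : ℕ) (q : Fin n) (x : Bool),
      A.phi i q x =
        if 1 ≤ q.val then ⟨q.val - 1, by have := q.isLt; omega⟩ else ⟨n - 1, by omega⟩)
    (hpsi : ∀ (i : ℕ) (q : Fin n) (x : Bool), A.psi i q x = if q.val = 0 then !x else x) :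
    ∃ h : A.Invertible, Nonempty (A.genGroup h ≃* Multiplicative (Fin n → ZMod 2)) := by
  have h : A.Invertible := fun i q => by
    have hq : A.psi i q = fun x => if q.val = 0 then !x else x := funext (hpsi i q)
    rw [hq]
    split_ifs
    · exact Bool.involutive_not.bijective
    · exact Function.bijective_id
  have hact : ∀ (w : List Bool) (i : ℕ) (q : Fin n),
      A.act i q w = toggleWord (fun k => if k % n = q.val then 1 else 0) w := by
    intro w
    induction w with
    | nil => intro i q; rfl
    | cons x w ih =>
      intro i q
      rw [TVAutomaton.act, toggleWord, ih, hpsi, hphi]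
      congr 1
      · by_cases hq : q.val = 0 <;> simp [hq, eq_comm]
      · congr 1
        funext k
        refine if_congr ?_ rfl rfl
        rw [succ_mod_eq_iff hn k q.val q.isLt]
        split_ifs <;> rfl
  let F : Multiplicative (Fin n → ZMod 2) →* ↥binTreeAut :=
    toggleHom.comp (AddMonoidHom.toMultiplicative (periodicExtension hn))
  have hF : Function.Injective F := toggleHom_injective.comp (periodicExtension_injective hn)
  have hgen : ∀ q, F (Multiplicative.ofAdd (Pi.single q 1)) = A.toAut h 0 q := by
    intro q
    refine Subtype.ext (Equiv.ext fun w => ?_)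
    change toggleWord (periodicExtension hn (Pi.single q 1)) w = A.act 0 q w
    rw [hact, funext (periodicExtension_single hn q)]
  have hrange : F.range = A.genGroup h := by
    rw [MonoidHom.range_eq_map, ← closure_range_ofAdd_single, MonoidHom.map_closure,
      ← Set.range_comp, TVAutomaton.genGroup]
    exact congrArg (fun f => Subgroup.closure (Set.range f)) (funext hgen)
  exact ⟨h, ⟨((MonoidHom.ofInjective hF).trans (MulEquiv.subgroupCongr hrange)).symm⟩⟩
end

section
/- There exist infinitely many pairwise non-isomorphic groups each of which is generated by an invertible 2-state time-varying automaton over the binary alphabet {0,1}. -/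
namespace TVAutomaton

/-- The binary odometer truncated at level `k`: state `0` is inactive and state `1` adds one with
carry to the first `k` letters of a word. -/
def truncatedOdometer (k : ℕ) : TVAutomaton (Fin 2) where
  phi _ q x := if q = 1 ∧ x = true then 1 else 0
  psi i q x := if q = 1 ∧ i < k then !x else x

theorem truncatedOdometer_invertible (k : ℕ) : (truncatedOdometer k).Invertible := by
  intro i q
  by_cases h : q = 1 ∧ i < k
  · have : (truncatedOdometer k).psi i q = Bool.not := by
      funext x; simp [truncatedOdometer, h]
    rw [this]
    exact Bool.involutive_not.bijective
  · have : (truncatedOdometer k).psi i q = id := by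
      funext x; simp only [truncatedOdometer, if_neg h, id]
    rw [this]
    exact Function.bijective_id

theorem truncatedOdometer_act_zero (k : ℕ) (w : List Bool) (i : ℕ) :
    (truncatedOdometer k).act i 0 w = w := by
  induction w generalizing i with
  | nil => rfl
  | cons x w ih => simpa [act, truncatedOdometer] using ih (i + 1)

theorem truncatedOdometer_act_of_le (k : ℕ) (w : List Bool) (i : ℕ) (q : Fin 2) (h : k ≤ i) :
    (truncatedOdometer k).act i q w = w := by
  induction w generalizing i q with
  | nil => rfl
  | cons x w ih =>
    rw [act, ih (i + 1) _ (by omega)]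
    simp [truncatedOdometer, h.not_gt]

theorem truncatedOdometer_act_one_cons {k i : ℕ} (h : i < k) (x : Bool) (w : List Bool) :
    (truncatedOdometer k).act i 1 (x :: w) =
      (!x) :: if x then (truncatedOdometer k).act (i + 1) 1 w else w := by
  have h0 := truncatedOdometer_act_zero k w (i + 1)
  cases x <;> simp_all [act, truncatedOdometer]

theorem truncatedOdometer_iterate_two_mul {k i : ℕ} (h : i < k) (n : ℕ) (x : Bool)
    (w : List Bool) :
    ((truncatedOdometer k).act i 1)^[2 * n] (x :: w) =
      x :: ((truncatedOdometer k).act (i + 1) 1)^[n] w := by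
  induction n generalizing w with
  | zero => rfl
  | succ n ih =>
    have hstep : 2 * (n + 1) = 2 * n + 1 + 1 := by ring
    rw [hstep, Function.iterate_succ_apply, Function.iterate_succ_apply,
      Function.iterate_succ_apply, truncatedOdometer_act_one_cons h,
      truncatedOdometer_act_one_cons h, Bool.not_not, ih]
    cases x <;> simp

theorem truncatedOdometer_iterate_eq_id_iff (k d i n : ℕ) (hd : i + d = k) :
    (∀ w, ((truncatedOdometer k).act i 1)^[n] w = w) ↔ 2 ^ d ∣ n := by
  induction d generalizing i n with
  | zero =>
    have hid : (truncatedOdometer k).act i 1 = id :=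
      funext fun w => truncatedOdometer_act_of_le k w i 1 (by omega)
    simp [hid]
  | succ d ih =>
    have hi : i < k := by omega
    rcases Nat.even_or_odd' n with ⟨m, rfl | rfl⟩
    · rw [pow_succ', Nat.mul_dvd_mul_iff_left two_pos, ← ih (i + 1) m (by omega)]
      constructor
      · intro h w
        have := h (true :: w)
        rw [truncatedOdometer_iterate_two_mul hi] at this
        exact (List.cons.inj this).2
      · rintro h (_ | ⟨x, w⟩)
        · exact Function.iterate_fixed rfl _
        · rw [truncatedOdometer_iterate_two_mul hi, h]
    · constructor
      · intro h
        have := h [false]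
        rw [Function.iterate_succ_apply, truncatedOdometer_act_one_cons hi,
          truncatedOdometer_iterate_two_mul hi] at this
        simp at this
      · intro h
        have : 2 ∣ 2 * m + 1 := (dvd_pow_self 2 d.succ_ne_zero).trans h
        omega

theorem orderOf_truncatedOdometer (k : ℕ) :
    orderOf ((truncatedOdometer k).toAut (truncatedOdometer_invertible k) 0 1) = 2 ^ k := by
  refine Nat.dvd_right_iff_eq.mp fun n => ?_
  rw [← truncatedOdometer_iterate_eq_id_iff k k 0 n (zero_add k), orderOf_dvd_iff_pow_eq_one,
    Subtype.ext_iff, Subgroup.coe_pow, Subgroup.coe_one, Equiv.ext_iff]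
  refine forall_congr' fun w => ?_
  rw [Equiv.Perm.coe_pow]
  rfl

theorem card_genGroup_truncatedOdometer (k : ℕ) :
    Nat.card ((truncatedOdometer k).genGroup (truncatedOdometer_invertible k)) = 2 ^ k := by
  have hzero : (truncatedOdometer k).toAut (truncatedOdometer_invertible k) 0 0 = 1 :=
    Subtype.ext (Equiv.ext fun w => truncatedOdometer_act_zero k w 0)
  have hrange : (Set.range fun q => (truncatedOdometer k).toAut (truncatedOdometer_invertible k) 0 q)
      = {1, (truncatedOdometer k).toAut (truncatedOdometer_invertible k) 0 1} := by
    ext g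
    simp [Fin.exists_fin_two, hzero, eq_comm]
  rw [genGroup, hrange, Subgroup.closure_insert_one, ← Subgroup.zpowers_eq_closure,
    Nat.card_zpowers, orderOf_truncatedOdometer]

end TVAutomaton

/-- There exist infinitely many pairwise non-isomorphic groups each of which
is generated by an invertible 2-state time-varying automaton over the binary alphabet. -/
theorem tva_two_states_infinitely_many_groups :
    ∃ Gs : ℕ → Subgroup ↥binTreeAut,
      (∀ k, ∃ (A : TVAutomaton (Fin 2)) (h : A.Invertible), Gs k = A.genGroup h) ∧
      (∀ k l, k ≠ l → IsEmpty ((Gs k) ≃* (Gs l))) := by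
  refine ⟨fun k => (TVAutomaton.truncatedOdometer k).genGroup
    (TVAutomaton.truncatedOdometer_invertible k), fun k => ⟨_, _, rfl⟩, fun k l hkl => ⟨fun e => ?_⟩⟩
  have hcard := Nat.card_congr e.toEquiv
  rw [TVAutomaton.card_genGroup_truncatedOdometer,
    TVAutomaton.card_genGroup_truncatedOdometer] at hcard
  exact hkl (Nat.pow_right_injective le_rfl hcard)
end

section
/- Let (a_i)_{i≥1} be a sequence of automorphisms of the rooted binary tree X* (X = {0,1}) satisfying the wreath recursion a_i = (id, a_{i+1})τ for every i ≥ 1, i.e., a_i(0w) = 1w and a_i(1w) = 0·a_{i+1}(w) for all w ∈ X*. Then a_1 has infinite order. -/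
/-- An even power of a transformation with wreath recursion `(id, g)τ` acts on words starting
with `0` as a power of `g` on the remaining letters. -/
theorem pow_two_mul_apply_false_cons {f g : Equiv.Perm (List Bool)}
    (h0 : ∀ w, f (false :: w) = true :: w) (h1 : ∀ w, f (true :: w) = false :: g w)
    (m : ℕ) (w : List Bool) : (f ^ (2 * m)) (false :: w) = false :: (g ^ m) w := by
  induction m generalizing w with
  | zero => rfl
  | succ m ih =>
    rw [Nat.mul_succ, pow_add, pow_two, Equiv.Perm.mul_apply, Equiv.Perm.mul_apply, h0, h1, ih,
      pow_succ, Equiv.Perm.mul_apply]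

/-- Nontrivial powers of permutations of the binary words satisfying the wreath recursions
`f i = (id, f (i + 1))τ` are not the identity. -/
theorem pow_ne_one_of_adding_machine {f : ℕ → Equiv.Perm (List Bool)}
    (h0 : ∀ i, 1 ≤ i → ∀ w, f i (false :: w) = true :: w)
    (h1 : ∀ i, 1 ≤ i → ∀ w, f i (true :: w) = false :: f (i + 1) w)
    {n : ℕ} (hn : 0 < n) {i : ℕ} (hi : 1 ≤ i) : f i ^ n ≠ 1 := by
  induction n using Nat.strong_induction_on generalizing i with
  | _ n ih =>
    intro h
    obtain ⟨m, rfl | rfl⟩ := n.even_or_odd'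
    · refine ih m (by omega) (by omega) (Nat.le_add_left 1 i) (Equiv.ext fun w => ?_)
      have hw := pow_two_mul_apply_false_cons (h0 i hi) (h1 i hi) m w
      rw [h] at hw
      exact (List.cons.inj hw).2.symm
    · have hw := congrArg (fun g => g [false]) h
      simp [pow_succ', pow_two_mul_apply_false_cons (h0 i hi) (h1 i hi), h0 i hi] at hw

/-- If `(a_i)_{i ≥ 1}` is a sequence of automorphisms of the rooted binary
tree satisfying the wreath recursions `a_i = (id, a_{i+1})τ`, i.e. `a_i(0w) = 1w` and
`a_i(1w) = 0 ⬝ a_{i+1}(w)` (with `0 = false`, `1 = true`), then `a_1` has infinite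
order. -/
theorem adding_machine_infinite_order (a : ℕ → ↥binTreeAut)
    (h0 : ∀ i : ℕ, 1 ≤ i → ∀ w : List Bool,
      (a i : Equiv.Perm (List Bool)) (false :: w) = true :: w)
    (h1 : ∀ i : ℕ, 1 ≤ i → ∀ w : List Bool,
      (a i : Equiv.Perm (List Bool)) (true :: w) =
        false :: (a (i + 1) : Equiv.Perm (List Bool)) w) :
    ¬ IsOfFinOrder (a 1) := by
  intro h
  obtain ⟨n, hn, hpow⟩ := isOfFinOrder_iff_pow_eq_one.mp h
  refine pow_ne_one_of_adding_machine (f := fun i => (a i : Equiv.Perm (List Bool))) h0 h1 hn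
    le_rfl ?_
  exact_mod_cast congrArg Subtype.val hpow
end
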